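/- Let f be a strongly measure expansive homeomorphism of a compact metric space with the shadowing property. Then the nonwandering set Ω(f) decomposes as a finite disjoint union of closed invariant sets B_1, ..., B_l (the chain equivalence classes), on each of which f is topologically transitive. -/

import Mathlib

open MeasureTheory Filter Metric Topology

variable {X : Type*}

/-- Iterate of a homeomorphism by an integer. -/
noncomputable def zit [TopologicalSpace X] (f : X ≃ₜ X) (i : ℤ) (x : X) : X :=
  (f.toEquiv ^ i) x

/-- The dynamical ball `Γ_δ(x)` of a homeomorphism. -/
def Gamma [MetricSpace X] (f : X ≃ₜ X) (δ : ℝ) (x : X) : Set X :=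
  {y | ∀ i : ℤ, dist (zit f i x) (zit f i y) ≤ δ}

/-- Shadowing property for one-sided (ℕ-indexed) pseudo-orbits. -/
def ShadowingN [MetricSpace X] (f : X → X) : Prop :=
  ∀ ε > (0 : ℝ), ∃ δ > (0 : ℝ), ∀ x : ℕ → X,
    (∀ i, dist (f (x i)) (x (i + 1)) < δ) →
    ∃ y, ∀ i, dist (f^[i] y) (x i) < ε

/-- Shadowing property for two-sided (ℤ-indexed) pseudo-orbits of a homeomorphism. -/
def ShadowingZ [MetricSpace X] (f : X ≃ₜ X) : Prop :=
  ∀ ε > (0 : ℝ), ∃ δ > (0 : ℝ), ∀ x : ℤ → X,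
    (∀ i, dist (f (x i)) (x (i + 1)) < δ) →
    ∃ y, ∀ i, dist (zit f i y) (x i) < ε

/-- Local weak specification property. -/
def LocalWeakSpec [MetricSpace X] (f : X → X) : Prop :=
  ∀ ε > (0 : ℝ), ∃ N : ℕ, ∃ δ > (0 : ℝ), ∀ n, N ≤ n → ∀ (k : ℕ) (x : ℕ → X),
    (∀ i, i + 1 < k → dist (f^[n] (x i)) (x (i + 1)) < δ) →
    ∃ y, ∀ i < k, ∀ j, i * n ≤ j → j < (i + 1) * n →
      dist (f^[j] y) (f^[j - i * n] (x i)) < ε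

/-- Local specification property (tracing point is periodic when the chain closes up). -/
def LocalSpec [MetricSpace X] (f : X → X) : Prop :=
  ∀ ε > (0 : ℝ), ∃ N : ℕ, ∃ δ > (0 : ℝ), ∀ n, N ≤ n → ∀ k, 1 ≤ k → ∀ x : ℕ → X,
    (∀ i < k, dist (f^[n] (x i)) (x ((i + 1) % k)) < δ) →
    ∃ y, f^[k * n] y = y ∧ ∀ i < k, ∀ j, i * n ≤ j → j < (i + 1) * n →
      dist (f^[j] y) (f^[j - i * n] (x i)) < ε

/-- A point is periodic for `f`. -/
def IsPeriodicPt' (f : X → X) (y : X) : Prop := ∃ m, 1 ≤ m ∧ f^[m] y = y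

/-- Periodic shadowing property for one-sided pseudo-orbits. -/
def PeriodicShadowingN [MetricSpace X] (f : X → X) : Prop :=
  ∀ ε > (0 : ℝ), ∃ δ > (0 : ℝ), ∀ x : ℕ → X,
    (∀ i, dist (f (x i)) (x (i + 1)) < δ) →
    (∃ M, 1 ≤ M ∧ ∀ i, x (i + M) = x i) →
    ∃ y, IsPeriodicPt' f y ∧ ∀ i, dist (f^[i] y) (x i) < ε

/-- Periodic shadowing property for two-sided pseudo-orbits of a homeomorphism. -/
def PeriodicShadowingZ [MetricSpace X] (f : X ≃ₜ X) : Prop :=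
  ∀ ε > (0 : ℝ), ∃ δ > (0 : ℝ), ∀ x : ℤ → X,
    (∀ i, dist (f (x i)) (x (i + 1)) < δ) →
    (∃ M : ℕ, 1 ≤ M ∧ ∀ i, x (i + M) = x i) →
    ∃ y, IsPeriodicPt' f y ∧ ∀ i, dist (zit f i y) (x i) < ε

/-- Strong periodic shadowing: the shadowing point has the same period as the pseudo-orbit. -/
def StrongPeriodicShadowingZ [MetricSpace X] (f : X ≃ₜ X) : Prop :=
  ∀ ε > (0 : ℝ), ∃ δ > (0 : ℝ), ∀ (N : ℕ), 1 ≤ N → ∀ x : ℤ → X,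
    (∀ i, dist (f (x i)) (x (i + 1)) < δ) →
    (∀ i, x (i + N) = x i) →
    ∃ y, f^[N] y = y ∧ ∀ i, dist (zit f i y) (x i) < ε

/-- Topological transitivity of a homeomorphism (some point has dense two-sided orbit). -/
def TransitiveZ [TopologicalSpace X] (f : X ≃ₜ X) : Prop :=
  ∃ x : X, Dense (Set.range fun n : ℤ => zit f n x)

/-- Measure expansiveness of a homeomorphism. -/
def MeasExpansive [MetricSpace X] [MeasurableSpace X] (f : X ≃ₜ X) : Prop :=
  ∃ δ > (0 : ℝ), ∀ μ : Measure X, IsProbabilityMeasure μ →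
    MeasurePreserving f μ μ → (∀ z : X, μ {z} = 0) →
    ∀ x : X, μ (Gamma f δ x) = 0

/-- Strong measure expansiveness of a homeomorphism. -/
def StrongMeasExpansive [MetricSpace X] [MeasurableSpace X] (f : X ≃ₜ X) : Prop :=
  ∃ δ > (0 : ℝ), ∀ μ : Measure X, IsProbabilityMeasure μ →
    MeasurePreserving f μ μ → ∀ x : X, μ (Gamma f δ x) = μ {x}

/-- Strong measure expansiveness with a specified constant. -/
def StrongMeasExpansiveWith [MetricSpace X] [MeasurableSpace X] (f : X ≃ₜ X) (δ : ℝ) : Prop :=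
  ∀ μ : Measure X, IsProbabilityMeasure μ →
    MeasurePreserving f μ μ → ∀ x : X, μ (Gamma f δ x) = μ {x}

/-- The nonwandering set of a homeomorphism. -/
def NonWandering [TopologicalSpace X] (f : X ≃ₜ X) : Set X :=
  {x | ∀ U ∈ nhds x, ∃ n : ℕ, 1 ≤ n ∧ ((⇑f)^[n] '' U ∩ U).Nonempty}

/-- The empirical measure of the first `n + 1` points of the orbit of `y`. -/
noncomputable def empiricalMeasure [MeasurableSpace X] (f : X → X) (y : X) (n : ℕ) : Measure X :=
  ((n + 1 : ℕ) : ENNReal)⁻¹ • ∑ i ∈ Finset.range (n + 1), Measure.dirac (f^[i] y)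

instance [MeasurableSpace X] (f : X → X) (y : X) (n : ℕ) :
    IsProbabilityMeasure (empiricalMeasure f y n) := by
  constructor
  simp only [empiricalMeasure, Measure.smul_apply, Measure.finsetSum_apply, measure_univ,
    Finset.sum_const, Finset.card_range, smul_eq_mul, nsmul_eq_mul, mul_one]
  exact ENNReal.inv_mul_cancel (by simp) (by simp)

lemma integral_empiricalMeasure [MeasurableSpace X] [MeasurableSingletonClass X]
    (f : X → X) (y : X) (n : ℕ) (φ : X → ℝ) :
    ∫ x, φ x ∂(empiricalMeasure f y n) = birkhoffAverage ℝ f φ (n + 1) y := by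
  rw [empiricalMeasure, integral_smul_measure, integral_finsetSum_measure]
  · simp [birkhoffAverage, birkhoffSum, ENNReal.toReal_inv, -Nat.cast_add]
  · intro i _
    exact integrable_dirac (by simp)

/-- Every orbit of a continuous self-map of a compact metric space carries an invariant
probability measure concentrated on its omega-limit set. -/
lemma exists_invariant_measure_null_of_not_mapClusterPt
    [MetricSpace X] [CompactSpace X] [MeasurableSpace X] [BorelSpace X]
    {f : X → X} (hf : Continuous f) (y : X) :
    ∃ μ : Measure X, IsProbabilityMeasure μ ∧ MeasurePreserving f μ μ ∧
      μ {w | ¬ MapClusterPt w atTop (fun n => f^[n] y)} = 0 := by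
  let U : Ultrafilter ℕ := hyperfilter ℕ
  have hU : (U : Filter ℕ) ≤ atTop := Nat.hyperfilter_le_atTop
  let ν : ℕ → ProbabilityMeasure X := fun n => ⟨empiricalMeasure f y n, inferInstance⟩
  obtain ⟨m, -, hm⟩ := isCompact_univ.ultrafilter_le_nhds (U.map ν) (by simp)
  have hlim : ∀ φ : BoundedContinuousFunction X ℝ,
      Tendsto (fun n : ℕ => birkhoffAverage ℝ f φ (n + 1) y) U (𝓝 (∫ x, φ x ∂(m : Measure X))) := by
    intro φ
    have h := (ProbabilityMeasure.tendsto_iff_forall_integral_tendsto (F := (U : Filter ℕ))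
      (μs := ν) (μ := m)).1 hm φ
    refine h.congr fun n => ?_
    exact integral_empiricalMeasure f y n φ
  refine ⟨m, inferInstance, ⟨hf.measurable, ?_⟩, ?_⟩
  · have : IsProbabilityMeasure ((m : Measure X).map f) :=
      Measure.isProbabilityMeasure_map hf.measurable.aemeasurable
    refine ext_of_forall_integral_eq_of_IsFiniteMeasure fun φ => ?_
    rw [integral_map hf.measurable.aemeasurable φ.continuous.aestronglyMeasurable]
    have h1 := hlim (φ.compContinuous ⟨f, hf⟩)
    have h2 := hlim φ
    have h3 : Tendsto (fun n : ℕ => birkhoffAverage ℝ f φ (n + 1) (f y) -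
        birkhoffAverage ℝ f φ (n + 1) y) U (𝓝 0) :=
      (((tendsto_birkhoffAverage_apply_sub_birkhoffAverage' ℝ
        φ.isBounded_range f y).comp (tendsto_add_atTop_nat 1))).mono_left hU
    have h4 := h2.add h3
    refine tendsto_nhds_unique (h1.congr fun n => ?_) (by simpa using h4)
    simp [birkhoffAverage, birkhoffSum, ← Function.iterate_succ_apply, Function.iterate_succ_apply']
  · refine measure_null_of_locally_null _ fun w hw => ?_
    rw [Set.mem_ofPred_eq, mapClusterPt_iff_frequently] at hw
    push Not at hw
    obtain ⟨s, hs, hev⟩ := hw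
    obtain ⟨ρ, hρ, hball⟩ := Metric.mem_nhds_iff.1 hs
    refine ⟨ball w ρ, mem_nhdsWithin_of_mem_nhds (ball_mem_nhds w hρ), ?_⟩
    let φ : BoundedContinuousFunction X ℝ :=
      BoundedContinuousFunction.mkOfCompact ⟨fun z => max 0 (ρ - dist z w), by fun_prop⟩
    have hφ : ∀ z, φ z = max 0 (ρ - dist z w) := fun z => rfl
    have h0 : Tendsto (fun n => φ (f^[n] y)) atTop (𝓝 0) := by
      refine tendsto_const_nhds.congr' ?_
      filter_upwards [hev] with n hn
      have : ¬ dist (f^[n] y) w < ρ := fun h => hn (hball h)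
      rw [hφ, max_eq_left (by linarith)]
    have h1 : Tendsto (fun n : ℕ => birkhoffAverage ℝ f φ (n + 1) y) U (𝓝 0) :=
      (h0.cesaro_smul.comp (tendsto_add_atTop_nat 1)).mono_left hU
    have h2 : ∫ x, φ x ∂(m : Measure X) = 0 := tendsto_nhds_unique (hlim φ) h1
    rw [integral_eq_zero_iff_of_nonneg (fun z => by simp [hφ]) (φ.integrable _)] at h2
    refine measure_mono_null (fun z hz => ?_) h2
    simpa [hφ] using hz

section IntegerIterates

variable [TopologicalSpace X] (f : X ≃ₜ X)

lemma zit_natCast (n : ℕ) (x : X) : zit f n x = f^[n] x := by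
  rw [zit, zpow_natCast, ← Equiv.Perm.iterate_eq_pow]
  rfl

@[simp] lemma zit_zero (x : X) : zit f 0 x = x := rfl

@[simp] lemma zit_one (x : X) : zit f 1 x = f x := by simp [zit]

lemma zit_add (i j : ℤ) (x : X) : zit f (i + j) x = zit f i (zit f j x) := by
  simp [zit, zpow_add]

lemma apply_zit (i : ℤ) (x : X) : f (zit f i x) = zit f (i + 1) x := by
  rw [add_comm, zit_add, zit_one]

lemma zit_symm (i : ℤ) (x : X) : zit f.symm i x = zit f (-i) x := by
  have : f.symm.toEquiv = (f.toEquiv : Equiv.Perm X)⁻¹ := rfl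
  rw [zit, zit, this, inv_zpow']

lemma continuous_zit (i : ℤ) : Continuous (zit f i) := by
  obtain ⟨n, rfl | rfl⟩ := i.eq_nat_or_neg
  · simpa only [← funext (zit_natCast f n)] using f.continuous.iterate n
  · have h : zit f (-(n : ℤ)) = f.symm^[n] := by
      funext x
      rw [← zit_symm, zit_natCast]
    exact h ▸ f.symm.continuous.iterate n

lemma zit_mul_of_iterate_eq {m : ℕ} {p : X} (hp : f^[m] p = p) (k : ℤ) :
    zit f (k * m) p = p := by
  have h : (f.toEquiv ^ (m : ℤ)) p = p := (zit_natCast f m p).trans hp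
  rw [zit, mul_comm, zpow_mul]
  exact Function.IsFixedPt.perm_zpow h k

end IntegerIterates

section Gamma

variable [MetricSpace X] (f : X ≃ₜ X)

lemma Gamma_symm (δ : ℝ) (x : X) : Gamma f.symm δ x = Gamma f δ x := by
  ext y
  simp only [Gamma, zit_symm, Set.mem_ofPred_eq]
  exact ⟨fun h i => by simpa using h (-i), fun h i => h (-i)⟩

variable {f}

lemma StrongMeasExpansiveWith.symm [MeasurableSpace X] [BorelSpace X] {δ : ℝ}
    (h : StrongMeasExpansiveWith f δ) : StrongMeasExpansiveWith f.symm δ := by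
  intro μ hμ hmp x
  rw [Gamma_symm]
  exact h μ hμ (hmp.symm f.symm.toMeasurableEquiv) x

lemma isPeriodicPt'_of_measure_singleton_ne_zero [MeasurableSpace X] [BorelSpace X]
    {g : X → X} {μ : Measure X} [IsProbabilityMeasure μ] (hg : MeasurePreserving g μ μ) {w : X}
    (hw : μ {w} ≠ 0) : IsPeriodicPt' g w := by
  obtain ⟨x, hx, m, hm, hmx⟩ := hg.exists_mem_iterate_mem
    (measurableSet_singleton w).nullMeasurableSet hw
  obtain rfl : x = w := hx
  exact ⟨m, Nat.one_le_iff_ne_zero.2 hm, hmx⟩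

/-- A cluster point of a forward orbit which stays close to a periodic sequence `x` stays close to
a shift of `x`. -/
lemma exists_shift_of_mapClusterPt {x : ℤ → X} {N : ℕ} (hN : 1 ≤ N)
    (hx : ∀ i, x (i + N) = x i) {ε : ℝ} {y z : X}
    (hy : ∀ j : ℕ, dist (f^[j] y) (x j) ≤ ε) (hz : MapClusterPt z atTop (fun n => f^[n] y)) :
    ∃ r ∈ Finset.range N, ∀ j : ℤ, dist (zit f j z) (x (j + r)) ≤ ε := by
  obtain ⟨U, hU, hlim⟩ := mapClusterPt_iff_ultrafilter.1 hz
  have hper : ∀ (i : ℤ) (k : ℕ), x (i + N * k) = x i := by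
    intro i k
    induction k with
    | zero => simp
    | succ k ih => rw [← ih, ← hx (i + N * k)]; congr 1; push_cast; ring
  have hmem : (⋃ r ∈ (Finset.range N : Set ℕ), {n : ℕ | n % N = r}) ∈ U := by
    refine mem_of_superset univ_mem fun n _ => ?_
    simpa using Nat.mod_lt n hN
  obtain ⟨r, hr, hrU⟩ := (Ultrafilter.finite_biUnion_mem_iff (Finset.finite_toSet _)).1 hmem
  refine ⟨r, by simpa using hr, fun j => ?_⟩
  have hcont : Tendsto (fun n => dist (zit f j (f^[n] y)) (x (j + r))) U
      (𝓝 (dist (zit f j z) (x (j + r)))) :=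
    (((continuous_zit f j).tendsto z).comp hlim).dist tendsto_const_nhds
  refine le_of_tendsto hcont ?_
  filter_upwards [hrU, hU (eventually_ge_atTop j.natAbs)] with n hn hnj
  have hn : n % N = r := hn
  obtain ⟨k, hk⟩ : ∃ k : ℕ, j + n = k := ⟨(j + n).toNat, by
    have : j.natAbs ≤ n := hnj
    omega⟩
  have h1 : x (j + r) = x k := by
    rw [← hk, ← Nat.mod_add_div n N, hn, ← hper (j + r) (n / N)]
    congr 1
    push_cast
    ring
  rw [h1, ← zit_natCast, ← zit_add, hk, zit_natCast]
  exact hy k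

/-- Under strong measure expansivity, a point whose full orbit is close to a periodic sequence is
periodic, and it is a limit point of every forward orbit which is close to that sequence. -/
lemma StrongMeasExpansiveWith.isPeriodicPt'_and_mapClusterPt [CompactSpace X] [MeasurableSpace X]
    [BorelSpace X] {δ : ℝ} (h : StrongMeasExpansiveWith f δ) {x : ℤ → X} {N : ℕ} (hN : 1 ≤ N)
    (hx : ∀ i, x (i + N) = x i) {ε : ℝ} (hε : 2 * ε ≤ δ) {y w : X}
    (hy : ∀ j : ℕ, dist (f^[j] y) (x j) ≤ ε) (hw : ∀ j : ℤ, dist (zit f j w) (x j) ≤ ε) :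
    IsPeriodicPt' f w ∧ MapClusterPt w atTop (fun n => f^[n] y) := by
  obtain ⟨μ, hμ, hmp, hnull⟩ := exists_invariant_measure_null_of_not_mapClusterPt f.continuous y
  let A : ℕ → Set X := fun r => {z | ∀ j : ℤ, dist (zit f j z) (x (j + r)) ≤ ε}
  have hA : ∃ r ∈ Finset.range N, μ (A r) ≠ 0 := by
    by_contra! hzero
    have h1 : μ (⋃ r ∈ Finset.range N, A r) = 0 :=
      (measure_biUnion_null_iff (Finset.range N).countable_toSet).2 hzero
    have h2 : μ (Set.univ : Set X) = 0 := by
      refine measure_mono_null (fun z _ => ?_) (measure_union_null h1 hnull)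
      by_cases hz : MapClusterPt z atTop (fun n => f^[n] y)
      · left
        simpa [A] using exists_shift_of_mapClusterPt hN hx hy hz
      · exact Or.inr hz
    simp at h2
  obtain ⟨r, -, hr⟩ := hA
  have hsub : A r ⊆ Gamma f δ (f^[r] w) := by
    intro z hz j
    have h1 := hw (j + r)
    rw [zit_add, zit_natCast] at h1
    have h2 : dist (zit f j z) (x (j + r)) ≤ ε := hz j
    have h3 := dist_triangle_right (zit f j (f^[r] w)) (zit f j z) (x (j + r))
    linarith
  have hne : μ {f^[r] w} ≠ 0 := by
    rw [← h μ hμ hmp]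
    exact fun h0 => hr (measure_mono_null hsub h0)
  have hpos : μ {w} ≠ 0 := by
    have h1 := (hmp.iterate r).measure_preimage (measurableSet_singleton (f^[r] w)).nullMeasurableSet
    have h2 : f^[r] ⁻¹' {f^[r] w} = {w} := by
      ext z
      simp [(f.injective.iterate r).eq_iff]
    rwa [← h1, h2] at hne
  refine ⟨isPeriodicPt'_of_measure_singleton_ne_zero hmp hpos, ?_⟩
  by_contra hcl
  exact hpos (measure_mono_null (by simpa using hcl) hnull)

end Gamma

lemma exists_seq_of_transGen {r : X → X → Prop} {a b : X} (h : Relation.TransGen r a b) :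
    ∃ (n : ℕ) (s : ℕ → X), 1 ≤ n ∧ s 0 = a ∧ s n = b ∧ ∀ i < n, r (s i) (s (i + 1)) := by
  induction h using Relation.TransGen.head_induction_on with
  | single hab =>
    rename_i a
    exact ⟨1, fun i => Nat.casesOn i a fun _ => b, le_rfl, rfl, rfl, fun i hi => by
      obtain rfl : i = 0 := by omega
      exact hab⟩
  | head hac _ ih =>
    rename_i a c _
    obtain ⟨n, s, hn, h0, hs, hr⟩ := ih
    refine ⟨n + 1, fun i => Nat.casesOn i a s, by omega, rfl, hs, fun i hi => ?_⟩
    cases i with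
    | zero =>
      change r _ (s 0)
      rwa [h0]
    | succ i => exact hr i (by omega)

lemma exists_seq_through_of_transGen {r : X → X → Prop} {a b c : X}
    (hab : Relation.TransGen r a b) (hbc : Relation.TransGen r b c) :
    ∃ (n : ℕ) (s : ℕ → X), s 0 = a ∧ s n = c ∧ (∀ i < n, r (s i) (s (i + 1))) ∧
      ∃ k < n, s k = b := by
  induction hab using Relation.TransGen.head_induction_on with
  | single hab =>
    rename_i a
    obtain ⟨n, s, hn, h0, hs, hr⟩ := exists_seq_of_transGen hbc
    refine ⟨n + 1, fun i => Nat.casesOn i a s, rfl, hs, fun i hi => ?_, 1, by omega, h0⟩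
    cases i with
    | zero =>
      change r _ (s 0)
      rwa [h0]
    | succ i => exact hr i (by omega)
  | head had _ ih =>
    rename_i a d _
    obtain ⟨n, s, h0, hs, hr, k, hk, hkb⟩ := ih
    refine ⟨n + 1, fun i => Nat.casesOn i a s, rfl, hs, fun i hi => ?_, k + 1, by omega, hkb⟩
    cases i with
    | zero =>
      change r _ (s 0)
      rwa [h0]
    | succ i => exact hr i (by omega)

lemma exists_periodic_seq {r : X → X → Prop} {a b : X}
    (hab : Relation.TransGen r a b) (hba : Relation.TransGen r b a) :
    ∃ (N : ℕ) (x : ℤ → X), 1 ≤ N ∧ (∀ i, x (i + N) = x i) ∧ (∀ i, r (x i) (x (i + 1))) ∧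
      x 0 = a ∧ ∃ k : ℕ, x k = b := by
  obtain ⟨N, s, h0, hN, hr, k, hk, hkb⟩ := exists_seq_through_of_transGen hab hba
  refine ⟨N, fun i => s (i % N).toNat, by omega, fun i => by simp, fun i => ?_, by simpa using h0,
    k, ?_⟩
  · have hpos : (0 : ℤ) < N := by omega
    have h1 := Int.emod_nonneg i hpos.ne'
    have h2 := Int.emod_lt_of_pos i hpos
    obtain ⟨t, ht⟩ := Int.eq_ofNat_of_zero_le h1
    have ht' : t < N := by omega
    have hstep := hr t ht'
    have hadd : (i + 1) % N = ((t + 1 : ℕ) : ℤ) % N := by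
      rw [Int.add_emod, ht, Nat.cast_add, Int.add_emod (t : ℤ), Int.emod_emod_of_dvd]
      · simp
      · simp
    simp only [ht, hadd, Int.toNat_natCast]
    rcases Nat.lt_or_ge (t + 1) N with hlt | hge
    · rw [← Int.natCast_mod, Nat.mod_eq_of_lt hlt]
      exact hstep
    · obtain rfl : t + 1 = N := by omega
      simpa [← hN, h0] using hstep
  · simpa [← Int.natCast_mod, Nat.mod_eq_of_lt hk] using hkb

section ChainRelation

/-- The relation "`b` can be reached from `a` by `ε`-chains, for every `ε > 0`". -/
def ChainRel [MetricSpace X] (f : X → X) (a b : X) : Prop :=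
  ∀ ε > (0 : ℝ), Relation.TransGen (fun u v => dist (f u) v < ε) a b

variable [MetricSpace X]

lemma ChainRel.trans {f : X → X} {a b c : X} (hab : ChainRel f a b) (hbc : ChainRel f b c) :
    ChainRel f a c := fun ε hε => (hab ε hε).trans (hbc ε hε)

lemma chainRel_iterate (f : X → X) {n : ℕ} (hn : 1 ≤ n) (a : X) : ChainRel f a (f^[n] a) := by
  intro ε hε
  induction n, hn using Nat.le_induction with
  | base => exact .single (by simpa using hε)
  | succ n _ ih => exact ih.tail (by simpa [Function.iterate_succ_apply'] using hε)

lemma transGen_perturb {f : X → X} {ε₁ ε₂ : ℝ} {a a' b b' : X}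
    (h : Relation.TransGen (fun u v => dist (f u) v < ε₁) a b) (ha : dist (f a) (f a') < ε₂)
    (hb : dist b b' < ε₂) :
    Relation.TransGen (fun u v => dist (f u) v < ε₁ + 2 * ε₂) a' b' := by
  have hε₂ : 0 < ε₂ := dist_nonneg.trans_lt hb
  have hmono : ∀ u v, dist (f u) v < ε₁ → dist (f u) v < ε₁ + 2 * ε₂ := fun u v h => by linarith
  obtain ⟨c, hac, hcb⟩ := Relation.TransGen.head'_iff.1 h
  have hac' : dist (f a') c < ε₁ + ε₂ := by
    have := dist_triangle_left (f a') c (f a)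
    linarith
  rcases Relation.ReflTransGen.cases_tail hcb with rfl | ⟨d, hcd, hdb⟩
  · refine .single ?_
    have := dist_triangle (f a') b b'
    linarith
  · have hdb' : dist (f d) b' < ε₁ + 2 * ε₂ := by
      have := dist_triangle (f d) b b'
      linarith
    refine Relation.TransGen.head' (by linarith) (.tail (Relation.ReflTransGen.mono hmono _ _ hcd) hdb')

lemma chainRel_of_forall_dist_lt {f : X → X} (hf : Continuous f) {a b : X}
    (h : ∀ ρ > (0 : ℝ), ∃ a' b', dist a' a < ρ ∧ dist b' b < ρ ∧ ChainRel f a' b') :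
    ChainRel f a b := by
  intro ε hε
  obtain ⟨ρ, hρ, hfρ⟩ := Metric.continuous_iff.1 hf a (ε / 4) (by linarith)
  obtain ⟨a', b', ha, hb, hab⟩ := h (min ρ (ε / 4)) (lt_min hρ (by linarith))
  have := transGen_perturb (hab (ε / 2) (by linarith)) (hfρ a' (ha.trans_le (min_le_left _ _)))
    (hb.trans_le (min_le_right _ _))
  rwa [show ε / 2 + 2 * (ε / 4) = ε by ring] at this

lemma chainRel_of_mapClusterPt {f : X → X} (hf : Continuous f) {y w : X}
    (h : MapClusterPt w atTop (fun n => f^[n] y)) : ChainRel f y w := by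
  refine chainRel_of_forall_dist_lt hf fun ρ hρ => ?_
  obtain ⟨n, hn, hn1⟩ := (((mapClusterPt_iff_frequently.1 h) _ (ball_mem_nhds w hρ)).and_eventually
    (eventually_ge_atTop 1)).exists
  exact ⟨y, f^[n] y, by simpa using hρ, hn, chainRel_iterate f hn1 y⟩

lemma chainRel_of_mapClusterPt_symm {f : X ≃ₜ X} {y w : X}
    (h : MapClusterPt w atTop (fun n => f.symm^[n] y)) : ChainRel f w y := by
  refine chainRel_of_forall_dist_lt f.continuous fun ρ hρ => ?_
  obtain ⟨n, hn, hn1⟩ := (((mapClusterPt_iff_frequently.1 h) _ (ball_mem_nhds w hρ)).and_eventually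
    (eventually_ge_atTop 1)).exists
  refine ⟨f.symm^[n] y, y, hn, by simpa using hρ, ?_⟩
  have := chainRel_iterate f hn1 (f.symm^[n] y)
  rwa [Function.LeftInverse.iterate f.apply_symm_apply n y] at this

end ChainRelation

section SpectralDecomposition

variable [MetricSpace X] {f : X ≃ₜ X}

lemma IsPeriodicPt'.chainRel_zit {p : X} (hp : IsPeriodicPt' f p) (i j : ℤ) :
    ChainRel f (zit f i p) (zit f j p) := by
  obtain ⟨m, hm, hp⟩ := hp
  have hpos : (0 : ℤ) < m := by omega
  obtain ⟨n, hn⟩ := Int.eq_ofNat_of_zero_le (Int.emod_nonneg (j - i) hpos.ne')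
  have h := chainRel_iterate f (show 1 ≤ n + m by omega) (zit f i p)
  have hj : ((n + m : ℕ) : ℤ) + i = j + (1 - (j - i) / m) * m := by
    have := Int.emod_add_mul_ediv (j - i) m
    push_cast
    linear_combination this - hn
  rwa [← zit_natCast, ← zit_add, hj, zit_add, zit_mul_of_iterate_eq f hp] at h

lemma IsPeriodicPt'.chainRel_self {p : X} (hp : IsPeriodicPt' f p) : ChainRel f p p :=
  hp.chainRel_zit 0 0

lemma isClosed_nonWandering : IsClosed (NonWandering f) := by
  rw [← isOpen_compl_iff, isOpen_iff_mem_nhds]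
  intro x hx
  simp only [NonWandering, Set.mem_compl_iff, Set.mem_ofPred_eq, not_forall] at hx
  obtain ⟨U, hU, hn⟩ := hx
  filter_upwards [eventually_mem_nhds_iff.2 hU] with z hz hzΩ
  exact hn (hzΩ U hz)

lemma chainRel_self_of_mem_nonWandering {x : X} (hx : x ∈ NonWandering f) : ChainRel f x x := by
  refine chainRel_of_forall_dist_lt f.continuous fun ρ hρ => ?_
  obtain ⟨n, hn, z, ⟨a, ha, rfl⟩, hz⟩ := hx (ball x ρ) (ball_mem_nhds x hρ)
  exact ⟨a, f^[n] a, ha, hz, chainRel_iterate f hn a⟩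

variable [CompactSpace X] [MeasurableSpace X] [BorelSpace X] {δ : ℝ}

/-- Two chain equivalent points are traced by a periodic orbit. -/
lemma exists_isPeriodicPt'_dist_lt (hδ : 0 < δ) (h : StrongMeasExpansiveWith f δ)
    (hsh : ShadowingZ f) {u v : X} (huv : ChainRel f u v) (hvu : ChainRel f v u) {ρ : ℝ}
    (hρ : 0 < ρ) : ∃ p, IsPeriodicPt' f p ∧ dist p u < ρ ∧ ∃ k : ℕ, dist (f^[k] p) v < ρ := by
  obtain ⟨η, hη, hsh⟩ := hsh (min ρ (δ / 2)) (lt_min hρ (by linarith))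
  obtain ⟨N, x, hN, hper, hstep, rfl, k, rfl⟩ := exists_periodic_seq (huv η hη) (hvu η hη)
  obtain ⟨p, hp⟩ := hsh x hstep
  refine ⟨p, ?_, (hp 0).trans_le (min_le_left _ _), k, ?_⟩
  · refine (h.isPeriodicPt'_and_mapClusterPt hN hper (show 2 * (δ / 2) ≤ δ by linarith)
      (y := p) (fun j => ?_) fun j => ((hp j).trans_le (min_le_right _ _)).le).1
    rw [← zit_natCast]
    exact ((hp j).trans_le (min_le_right _ _)).le
  · rw [← zit_natCast]
    exact (hp k).trans_le (min_le_left _ _)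

lemma mem_nonWandering_iff_chainRel_self (hδ : 0 < δ) (h : StrongMeasExpansiveWith f δ)
    (hsh : ShadowingZ f) {x : X} : x ∈ NonWandering f ↔ ChainRel f x x := by
  refine ⟨chainRel_self_of_mem_nonWandering, fun hx U hU => ?_⟩
  obtain ⟨ρ, hρ, hball⟩ := Metric.mem_nhds_iff.1 hU
  obtain ⟨p, ⟨m, hm, hp⟩, hpx, -⟩ := exists_isPeriodicPt'_dist_lt hδ h hsh hx hx hρ
  exact ⟨m, hm, p, ⟨p, hball hpx, hp⟩, hball hpx⟩

lemma ChainRel.zit_zit (hδ : 0 < δ) (h : StrongMeasExpansiveWith f δ)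
    (hsh : ShadowingZ f) {x : X} (hx : ChainRel f x x) (i j : ℤ) :
    ChainRel f (zit f i x) (zit f j x) := by
  refine chainRel_of_forall_dist_lt f.continuous fun ρ hρ => ?_
  obtain ⟨ρ₁, hρ₁, h₁⟩ := Metric.continuous_iff.1 (continuous_zit f i) x ρ hρ
  obtain ⟨ρ₂, hρ₂, h₂⟩ := Metric.continuous_iff.1 (continuous_zit f j) x ρ hρ
  obtain ⟨p, hp, hpx, -⟩ := exists_isPeriodicPt'_dist_lt hδ h hsh hx hx (lt_min hρ₁ hρ₂)
  exact ⟨zit f i p, zit f j p, h₁ p (hpx.trans_le (min_le_left _ _)),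
    h₂ p (hpx.trans_le (min_le_right _ _)), hp.chainRel_zit i j⟩

/-- Nearby periodic points are chain related. -/
lemma exists_forall_isPeriodicPt'_chainRel (hδ : 0 < δ) (h : StrongMeasExpansiveWith f δ)
    (hsh : ShadowingZ f) : ∃ η > 0, ∀ p q, IsPeriodicPt' f p → IsPeriodicPt' f q →
      dist p q < η → ChainRel f p q := by
  obtain ⟨η, hη, hsh⟩ := hsh (δ / 4) (by linarith)
  refine ⟨min η (δ / 4), lt_min hη (by linarith), ?_⟩
  rintro p q ⟨m, hm, hp⟩ ⟨n, hn, hq⟩ hpq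
  let x : ℤ → X := fun i => if i < 0 then zit f i p else zit f i q
  have hxneg : ∀ i < 0, x i = zit f i p := fun i hi => if_pos hi
  have hxnonneg : ∀ i, 0 ≤ i → x i = zit f i q := fun i hi => if_neg hi.not_gt
  obtain ⟨y, hy⟩ := hsh x fun i => by
    rcases lt_trichotomy i (-1) with hi | rfl | hi
    · rw [hxneg i (by omega), hxneg (i + 1) (by omega), apply_zit, dist_self]
      exact hη
    · rw [hxneg _ (by omega), hxnonneg _ (by omega), apply_zit]
      exact hpq.trans_le (min_le_left _ _)
    · rw [hxnonneg i (by omega), hxnonneg (i + 1) (by omega), apply_zit, dist_self]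
      exact hη
  have hyq : MapClusterPt q atTop (fun k => f^[k] y) := by
    refine (h.isPeriodicPt'_and_mapClusterPt (x := fun i => zit f i q) hn
      (fun i => ?_) (show 2 * (δ / 2) ≤ δ by linarith) (fun j => ?_)
      fun j => by rw [dist_self]; linarith).2
    · rw [zit_add, zit_natCast, hq]
    · have := hy j
      rw [hxnonneg _ (by omega), zit_natCast f j y] at this
      exact this.le.trans (by linarith)
  have hyp : MapClusterPt p atTop (fun k => f.symm^[k] y) := by
    refine (h.symm.isPeriodicPt'_and_mapClusterPt (x := fun i => zit f (-i) p) hm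
      (fun i => ?_) (show 2 * (δ / 2) ≤ δ by linarith) (fun j => ?_)
      fun j => by rw [zit_symm, dist_self]; linarith).2
    · have := zit_mul_of_iterate_eq f hp (-1)
      rw [neg_add, zit_add, ← neg_one_mul (m : ℤ), this]
    · rw [← zit_natCast, zit_symm]
      rcases Nat.eq_zero_or_pos j with rfl | hj
      · have h1 := hy 0
        rw [hxnonneg _ le_rfl, zit_zero, zit_zero] at h1
        have h2 := hpq.trans_le (min_le_right _ _)
        have h3 := dist_triangle_right y p q
        simp only [Nat.cast_zero, neg_zero, zit_zero]
        linarith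
      · have := hy (-j)
        rw [hxneg _ (by omega)] at this
        linarith
  exact (chainRel_of_mapClusterPt_symm hyp).trans (chainRel_of_mapClusterPt f.continuous hyq)

/-- Nearby chain recurrent points are chain related. -/
lemma exists_forall_dist_lt_chainRel (hδ : 0 < δ) (h : StrongMeasExpansiveWith f δ)
    (hsh : ShadowingZ f) : ∃ η > 0, ∀ x y, ChainRel f x x → ChainRel f y y →
      dist x y < η → ChainRel f x y := by
  obtain ⟨η, hη, hchain⟩ := exists_forall_isPeriodicPt'_chainRel hδ h hsh
  refine ⟨η / 3, by linarith, fun x y hx hy hxy => ?_⟩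
  refine chainRel_of_forall_dist_lt f.continuous fun ρ hρ => ?_
  have hpos : 0 < min ρ (η / 3) := lt_min hρ (by linarith)
  obtain ⟨p, hp, hpx, -⟩ := exists_isPeriodicPt'_dist_lt hδ h hsh hx hx hpos
  obtain ⟨q, hq, hqy, -⟩ := exists_isPeriodicPt'_dist_lt hδ h hsh hy hy hpos
  refine ⟨p, q, hpx.trans_le (min_le_left _ _), hqy.trans_le (min_le_left _ _),
    hchain p q hp hq ?_⟩
  have h1 := hpx.trans_le (min_le_right _ _)
  have h2 := hqy.trans_le (min_le_right _ _)
  have h3 := dist_triangle4_right p q x y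
  linarith

end SpectralDecomposition

theorem spectral_decomposition
    [MetricSpace X] [CompactSpace X] [MeasurableSpace X] [BorelSpace X]
    (f : X ≃ₜ X) (hsme : StrongMeasExpansive f) (hsh : ShadowingZ f) :
    ∃ (l : ℕ) (B : Fin l → Set X),
      (NonWandering f = ⋃ i, B i) ∧
      (∀ i, (B i).Nonempty ∧ IsClosed (B i) ∧ f '' B i = B i) ∧
      (Pairwise (Function.onFun Disjoint B)) ∧
      (∀ i, ∀ U V : Set X, IsOpen U → IsOpen V →
        (U ∩ B i).Nonempty → (V ∩ B i).Nonempty →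
        ∃ n : ℤ, ((zit f n '' (U ∩ B i)) ∩ (V ∩ B i)).Nonempty) := by
  obtain ⟨δ, hδ, hexp⟩ := hsme
  have h : StrongMeasExpansiveWith f δ := hexp
  have hΩ : ∀ {x}, x ∈ NonWandering f ↔ ChainRel f x x :=
    mem_nonWandering_iff_chainRel_self hδ h hsh
  obtain ⟨η, hη, hclose⟩ := exists_forall_dist_lt_chainRel hδ h hsh
  let S : Setoid (NonWandering f) :=
    { r := fun x y => ChainRel f x y ∧ ChainRel f y x
      iseqv := ⟨fun x => ⟨hΩ.1 x.2, hΩ.1 x.2⟩, fun h => h.symm,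
        fun h₁ h₂ => ⟨h₁.1.trans h₂.1, h₂.2.trans h₁.2⟩⟩ }
  have hmk : ∀ x y : NonWandering f, (⟦x⟧ : Quotient S) = ⟦y⟧ ↔
      ChainRel f x y ∧ ChainRel f y x := fun x y => Quotient.eq
  have hlocal : ∀ x y : NonWandering f, dist (x : X) y < η → (⟦x⟧ : Quotient S) = ⟦y⟧ :=
    fun x y hxy => (hmk x y).2 ⟨hclose _ _ (hΩ.1 x.2) (hΩ.1 y.2) hxy,
      hclose _ _ (hΩ.1 y.2) (hΩ.1 x.2) (by rwa [dist_comm])⟩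
  have hfin : Finite (Quotient S) := by
    have hcpt : CompactSpace (NonWandering f) :=
      isCompact_iff_compactSpace.1 isClosed_nonWandering.isCompact
    obtain ⟨t, -, ht, hcover⟩ := (isCompact_univ (X := NonWandering f)).finite_cover_balls hη
    refine Set.finite_univ_iff.1 ((ht.image (Quotient.mk S)).subset fun c _ => ?_)
    obtain ⟨x, rfl⟩ := Quotient.exists_rep c
    obtain ⟨y, hy, hxy⟩ := Set.mem_iUnion₂.1 (hcover (Set.mem_univ x))
    exact ⟨y, hy, (hlocal x y hxy).symm⟩
  obtain ⟨l, ⟨e⟩⟩ := Finite.exists_equiv_fin (Quotient S)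
  have hzit : ∀ (x : NonWandering f) (k : ℤ), ∃ y : NonWandering f,
      (y : X) = zit f k x ∧ (⟦y⟧ : Quotient S) = ⟦x⟧ := by
    intro x k
    have hx := hΩ.1 x.2
    refine ⟨⟨zit f k x, hΩ.2 (hx.zit_zit hδ h hsh k k)⟩, rfl, (hmk _ _).2 ⟨?_, ?_⟩⟩
    · exact hx.zit_zit hδ h hsh k 0
    · exact hx.zit_zit hδ h hsh 0 k
  refine ⟨l, fun i => Subtype.val '' {x : NonWandering f | e ⟦x⟧ = i}, ?_, fun i => ⟨?_, ?_, ?_⟩,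
    ?_, ?_⟩
  · ext x
    simp
  · obtain ⟨x, hx⟩ := Quotient.exists_rep (e.symm i)
    exact ⟨x, x, by simp [hx], rfl⟩
  · refine isClosed_nonWandering.isClosedEmbedding_subtypeVal.isClosedMap _ ?_
    rw [← isOpen_compl_iff, Metric.isOpen_iff]
    intro x hx
    refine ⟨η, hη, fun y hy hyi => hx ?_⟩
    rw [Set.mem_ofPred_eq, ← hlocal y x hy]
    exact hyi
  · ext z
    constructor
    · rintro ⟨-, ⟨x, hx, rfl⟩, rfl⟩
      obtain ⟨y, hy, hyx⟩ := hzit x 1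
      exact ⟨y, by simpa [hyx] using hx, by simpa using hy⟩
    · rintro ⟨x, hx, rfl⟩
      obtain ⟨y, hy, hyx⟩ := hzit x (-1)
      refine ⟨y, ⟨y, by simpa [hyx] using hx, rfl⟩, ?_⟩
      rw [hy, apply_zit]
      rfl
  · intro i j hij
    refine Set.disjoint_left.2 ?_
    rintro - ⟨x, hx, rfl⟩ ⟨y, hy, hxy⟩
    obtain rfl := Subtype.ext hxy
    exact hij (hx.symm.trans hy)
  · rintro i U V hU hV ⟨-, huU, u, hu, rfl⟩ ⟨-, hvV, v, hv, rfl⟩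
    obtain ⟨ρ₁, hρ₁, hU⟩ := Metric.isOpen_iff.1 hU _ huU
    obtain ⟨ρ₂, hρ₂, hV⟩ := Metric.isOpen_iff.1 hV _ hvV
    obtain ⟨huv, hvu⟩ := (hmk u v).1 (e.injective (hu.trans hv.symm))
    obtain ⟨p, hp, hpu, k, hkv⟩ := exists_isPeriodicPt'_dist_lt hδ h hsh huv hvu
      (lt_min (lt_min hρ₁ hρ₂) hη)
    let p' : NonWandering f := ⟨p, hΩ.2 hp.chainRel_self⟩
    have hp' : e ⟦p'⟧ = i := by
      rw [hlocal p' u (hpu.trans_le (min_le_right _ _))]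
      exact hu
    obtain ⟨y, hy, hyp⟩ := hzit p' k
    refine ⟨k, y, ⟨p, ⟨hU ?_, p', hp', rfl⟩, hy.symm⟩, hV ?_, y, ?_, rfl⟩
    · exact hpu.trans_le ((min_le_left _ _).trans (min_le_left _ _))
    · rw [hy, zit_natCast]
      exact hkv.trans_le ((min_le_left _ _).trans (min_le_right _ _))
    · rw [Set.mem_ofPred_eq, hyp]
      exact hp'
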